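/- arXiv:math/9912229 — 2 statements merged into one kernel-verified Lean document; each statement's English description precedes it below -/
import Mathlib

section
/- Let V be a finite-dimensional real vector space, σ a convex polyhedral cone in V, and W a linear subspace of V. Let σ_W denote the smallest face of σ containing W ∩ σ. Then σ_W is the largest face of σ whose relative interior meets W; that is, the relative interior of σ_W meets W, and every face τ of σ whose relative interior meets W is contained in σ_W. -/
open scoped Pointwise

/-- A (not necessarily strictly) convex cone, as a subset of a real vector space:
it contains `0` and is closed under addition and under scaling by nonnegative reals. -/
def IsConeSet {V : Type*} [AddCommGroup V] [Module ℝ V] (τ : Set V) : Prop :=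
  (0 : V) ∈ τ ∧ (∀ x ∈ τ, ∀ y ∈ τ, x + y ∈ τ) ∧ ∀ c : ℝ, 0 ≤ c → ∀ x ∈ τ, c • x ∈ τ

/-- `τ` is a face of the convex cone `σ`: a convex subcone such that whenever the sum of
two elements of `σ` lies in `τ`, both elements lie in `τ`. -/
def IsFaceOf {V : Type*} [AddCommGroup V] [Module ℝ V] (τ σ : Set V) : Prop :=
  IsConeSet τ ∧ τ ⊆ σ ∧ ∀ x ∈ σ, ∀ y ∈ σ, x + y ∈ τ → x ∈ τ ∧ y ∈ τ

/-- A convex polyhedral cone in a real vector space: the set of all nonnegative linear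
combinations of finitely many vectors. -/
def IsPolyCone {V : Type*} [AddCommGroup V] [Module ℝ V] (σ : Set V) : Prop :=
  ∃ (m : ℕ) (g : Fin m → V),
    σ = { x | ∃ c : Fin m → ℝ, (∀ k, 0 ≤ c k) ∧ x = ∑ k, c k • g k }

/-- The smallest face of the cone `σ` containing the subset `A ⊆ σ`. -/
def minFaceContaining {V : Type*} [AddCommGroup V] [Module ℝ V] (σ A : Set V) : Set V :=
  ⋂₀ { τ | IsFaceOf τ σ ∧ A ⊆ τ }

theorem IsPolyCone.isConeSet {V : Type*} [AddCommGroup V] [Module ℝ V] {σ : Set V}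
    (hσ : IsPolyCone σ) : IsConeSet σ := by
  obtain ⟨m, g, rfl⟩ := hσ
  refine ⟨⟨0, by simp, by simp⟩, ?_, ?_⟩
  · rintro _ ⟨a, ha, rfl⟩ _ ⟨b, hb, rfl⟩
    exact ⟨a + b, fun k => add_nonneg (ha k) (hb k), by
      simp [add_smul, Finset.sum_add_distrib]⟩
  · rintro c hc _ ⟨a, ha, rfl⟩
    exact ⟨c • a, fun k => mul_nonneg hc (ha k), by simp [Finset.smul_sum, mul_smul]⟩

theorem IsConeSet.convex {V : Type*} [AddCommGroup V] [Module ℝ V] {σ : Set V}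
    (hσ : IsConeSet σ) : Convex ℝ σ :=
  fun x hx y hy a b ha hb _ => hσ.2.1 _ (hσ.2.2 a ha x hx) _ (hσ.2.2 b hb y hy)

theorem IsConeSet.isFaceOf_self {V : Type*} [AddCommGroup V] [Module ℝ V] {σ : Set V}
    (hσ : IsConeSet σ) : IsFaceOf σ σ :=
  ⟨hσ, subset_rfl, fun _ hx _ hy _ => ⟨hx, hy⟩⟩

theorem subset_minFaceContaining {V : Type*} [AddCommGroup V] [Module ℝ V] (σ A : Set V) :
    A ⊆ minFaceContaining σ A :=
  Set.subset_sInter fun _ h => h.2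

theorem minFaceContaining_subset {V : Type*} [AddCommGroup V] [Module ℝ V] {σ A τ : Set V}
    (hτ : IsFaceOf τ σ) (hA : A ⊆ τ) : minFaceContaining σ A ⊆ τ :=
  Set.sInter_subset_of_mem ⟨hτ, hA⟩

theorem isFaceOf_minFaceContaining {V : Type*} [AddCommGroup V] [Module ℝ V] {σ A : Set V}
    (hσ : IsConeSet σ) (hA : A ⊆ σ) : IsFaceOf (minFaceContaining σ A) σ := by
  refine ⟨⟨fun τ h => h.1.1.1, fun x hx y hy τ h => h.1.1.2.1 x (hx τ h) y (hy τ h),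
    fun c hc x hx τ h => h.1.1.2.2 c hc x (hx τ h)⟩,
    minFaceContaining_subset hσ.isFaceOf_self hA, fun x hx y hy hxy => ?_⟩
  exact ⟨fun τ h => (h.1.2.2 x hx y hy (hxy τ h)).1, fun τ h => (h.1.2.2 x hx y hy (hxy τ h)).2⟩

/-- The elements of a cone `σ` dominated by an element of `W ∩ σ`, in the preorder defined
by `σ`, form a face of `σ`. -/
theorem isFaceOf_dominated {V : Type*} [AddCommGroup V] [Module ℝ V] {σ : Set V}
    (hσ : IsConeSet σ) (W : Submodule ℝ V) :
    IsFaceOf {x | x ∈ σ ∧ ∃ w ∈ (W : Set V) ∩ σ, w - x ∈ σ} σ := by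
  refine ⟨⟨⟨hσ.1, 0, ⟨W.zero_mem, hσ.1⟩, by simpa using hσ.1⟩, ?_, ?_⟩, fun x hx => hx.1, ?_⟩
  · rintro x ⟨hx, v, ⟨hvW, hv⟩, hvx⟩ y ⟨hy, w, ⟨hwW, hw⟩, hwy⟩
    refine ⟨hσ.2.1 _ hx _ hy, v + w, ⟨W.add_mem hvW hwW, hσ.2.1 _ hv _ hw⟩, ?_⟩
    rw [add_sub_add_comm]
    exact hσ.2.1 _ hvx _ hwy
  · rintro c hc x ⟨hx, v, ⟨hvW, hv⟩, hvx⟩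
    refine ⟨hσ.2.2 c hc _ hx, c • v, ⟨W.smul_mem c hvW, hσ.2.2 c hc _ hv⟩, ?_⟩
    rw [← smul_sub]
    exact hσ.2.2 c hc _ hvx
  · rintro x hx y hy ⟨-, w, hw, hwxy⟩
    refine ⟨⟨hx, w, hw, ?_⟩, ⟨hy, w, hw, ?_⟩⟩
    · convert hσ.2.1 _ hwxy _ hy using 1
      abel
    · convert hσ.2.1 _ hwxy _ hx using 1
      abel

theorem mem_intrinsicInterior_iff_dist {V : Type*} [NormedAddCommGroup V] [NormedSpace ℝ V]
    {s : Set V} {x : V} :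
    x ∈ intrinsicInterior ℝ s ↔
      x ∈ affineSpan ℝ s ∧ ∃ δ > 0, ∀ y ∈ affineSpan ℝ s, dist y x < δ → y ∈ s := by
  simp only [mem_intrinsicInterior, mem_interior_iff_mem_nhds, Metric.mem_nhds_iff]
  constructor
  · rintro ⟨x, ⟨δ, hδ, h⟩, rfl⟩
    exact ⟨x.2, δ, hδ, fun y hy hyx => @h ⟨y, hy⟩ hyx⟩
  · rintro ⟨hx, δ, hδ, h⟩
    exact ⟨⟨x, hx⟩, ⟨δ, hδ, fun y hy => h y y.2 hy⟩, rfl⟩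

theorem IsConeSet.add_mem_intrinsicInterior {V : Type*} [NormedAddCommGroup V]
    [NormedSpace ℝ V] {τ : Set V} (hτ : IsConeSet τ) {x r : V} (hx : x ∈ τ)
    (hr : r ∈ intrinsicInterior ℝ τ) : x + r ∈ intrinsicInterior ℝ τ := by
  have hrτ : r ∈ τ := intrinsicInterior_subset hr
  have hxr : x + r ∈ affineSpan ℝ τ := subset_affineSpan ℝ τ (hτ.2.1 _ hx _ hrτ)
  obtain ⟨hr', δ, hδ, h⟩ := mem_intrinsicInterior_iff_dist.1 hr
  refine mem_intrinsicInterior_iff_dist.2 ⟨hxr, δ, hδ, fun y hy hyx => ?_⟩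
  have hz : y - (x + r) + r ∈ affineSpan ℝ τ := by
    simpa using AffineSubspace.smul_vsub_vadd_mem _ (1 : ℝ) hy hxr hr'
  have hzτ := h _ hz (by simpa [dist_eq_norm] using hyx)
  convert hτ.2.1 _ hx _ hzτ using 1
  abel

theorem exists_sub_smul_mem_of_mem_intrinsicInterior {V : Type*} [NormedAddCommGroup V]
    [NormedSpace ℝ V] {s : Set V} (h0 : (0 : V) ∈ s) {w t : V}
    (hw : w ∈ intrinsicInterior ℝ s) (ht : t ∈ s) : ∃ ε : ℝ, 0 < ε ∧ w - ε • t ∈ s := by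
  obtain ⟨hw', δ, hδ, h⟩ := mem_intrinsicInterior_iff_dist.1 hw
  have hpos : 0 < ‖t‖ + 1 := by positivity
  refine ⟨δ / (‖t‖ + 1), by positivity, h _ ?_ ?_⟩
  · have := AffineSubspace.smul_vsub_vadd_mem _ (δ / (‖t‖ + 1)) (subset_affineSpan ℝ s h0)
      (subset_affineSpan ℝ s ht) hw'
    simpa [sub_eq_neg_add] using this
  · rw [dist_eq_norm, sub_sub_cancel_left, norm_neg, norm_smul, Real.norm_of_nonneg (by positivity),
      div_mul_eq_mul_div, div_lt_iff₀ hpos]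
    nlinarith

/-- A face containing a relative interior point of a subcone contains the whole subcone. -/
theorem IsFaceOf.subset_of_mem_intrinsicInterior {V : Type*} [NormedAddCommGroup V]
    [NormedSpace ℝ V] {σ τ ρ : Set V} (hρ : IsFaceOf ρ σ) (hτ : IsConeSet τ) (hτσ : τ ⊆ σ)
    {w : V} (hw : w ∈ intrinsicInterior ℝ τ) (hwρ : w ∈ ρ) : τ ⊆ ρ := by
  intro t ht
  obtain ⟨ε, hε, h⟩ := exists_sub_smul_mem_of_mem_intrinsicInterior hτ.1 hw ht
  have hεt : ε • t ∈ ρ :=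
    (hρ.2.2 _ (hτσ h) _ (hτσ (hτ.2.2 ε hε.le t ht)) (by simpa using hwρ)).2
  simpa [smul_smul, hε.ne'] using hρ.1.2.2 ε⁻¹ (by positivity) _ hεt

/-- **Section 5.**  For a convex polyhedral cone `σ` in a finite dimensional real vector
space and a linear subspace `W`, the smallest face `σ_W` of `σ` containing `W ∩ σ` is the
largest face of `σ` whose relative interior meets `W`: the relative interior of `σ_W`
meets `W`, and every face of `σ` whose relative interior meets `W` is contained in
`σ_W`. -/
theorem minFace_is_largest_face_with_relint_meeting
    {V : Type*} [NormedAddCommGroup V] [NormedSpace ℝ V] [FiniteDimensional ℝ V]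
    (σ : Set V) (hσ : IsPolyCone σ) (W : Submodule ℝ V) :
    IsFaceOf (minFaceContaining σ ((W : Set V) ∩ σ)) σ ∧
      (intrinsicInterior ℝ (minFaceContaining σ ((W : Set V) ∩ σ)) ∩ (W : Set V)).Nonempty ∧
      ∀ τ, IsFaceOf τ σ → (intrinsicInterior ℝ τ ∩ (W : Set V)).Nonempty →
        τ ⊆ minFaceContaining σ ((W : Set V) ∩ σ) := by
  have hcone := hσ.isConeSet
  have hface : IsFaceOf (minFaceContaining σ ((W : Set V) ∩ σ)) σ :=
    isFaceOf_minFaceContaining hcone Set.inter_subset_right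
  have hsub := subset_minFaceContaining σ ((W : Set V) ∩ σ)
  refine ⟨hface, ?_, fun τ hτ ⟨w, hw, hwW⟩ =>
    hface.subset_of_mem_intrinsicInterior hτ.1 hτ.2.1 hw
      (hsub ⟨hwW, hτ.2.1 (intrinsicInterior_subset hw)⟩)⟩
  obtain ⟨r, hr⟩ := Set.Nonempty.intrinsicInterior hface.1.convex ⟨0, hface.1.1⟩
  obtain ⟨hrσ, w, hw, hwr⟩ := minFaceContaining_subset (isFaceOf_dominated hcone W)
    (fun w hw => ⟨hw.2, w, hw, by simpa using hcone.1⟩) (intrinsicInterior_subset hr)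
  have hwr' := (hface.2.2 _ hwr _ hrσ (by simpa using hsub hw)).1
  exact ⟨w, by simpa using hface.1.add_mem_intrinsicInterior hwr' hr, hw.1⟩
end

section
/- Let Σ be a quasi-fan in a lattice N, let σ₀ := σ ∩ (−σ) be the common minimal face of all cones σ ∈ Σ, let L := σ₀ ∩ N, and let P : N → N/L denote the projection. Then the set Δ := {P_ℝ(σ) : σ ∈ Σ} is a fan in N/L. -/
open scoped TensorProduct Pointwise

/-- The relative interior of a convex cone (algebraic formulation, which for polyhedral
cones in a finite dimensional space agrees with the topological relative interior). -/
def coneRelint {V : Type*} [AddCommGroup V] [Module ℝ V] (σ : Set V) : Set V :=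
  { x | x ∈ σ ∧ ∀ y ∈ σ, ∃ ε : ℝ, 0 < ε ∧ x - ε • y ∈ σ }

/-- The real vector space `N_ℝ = ℝ ⊗_ℤ N` associated to a lattice `N`. -/
abbrev NR (N : Type*) [AddCommGroup N] : Type _ := ℝ ⊗[ℤ] N

/-- The canonical map `N → N_ℝ`, `n ↦ 1 ⊗ n`. -/
noncomputable def toNR {N : Type*} [AddCommGroup N] (n : N) : NR N := (1 : ℝ) ⊗ₜ[ℤ] n

/-- A rational polyhedral cone in the lattice `N`: a cone in `N_ℝ` generated by finitely
many lattice vectors. -/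
def IsRatCone {N : Type*} [AddCommGroup N] (σ : Set (NR N)) : Prop :=
  ∃ (m : ℕ) (v : Fin m → N),
    σ = { x | ∃ c : Fin m → ℝ, (∀ k, 0 ≤ c k) ∧ x = ∑ k, c k • toNR (v k) }

/-- A quasi-fan in the lattice `N`: a finite set of rational polyhedral cones, closed under
passing to faces, in which any two members intersect in a common face of both. -/
def IsQuasiFan {N : Type*} [AddCommGroup N] (Sig : Set (Set (NR N))) : Prop :=
  Sig.Finite ∧ (∀ σ ∈ Sig, IsRatCone σ) ∧
    (∀ σ ∈ Sig, ∀ τ, IsFaceOf τ σ → τ ∈ Sig) ∧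
    ∀ σ ∈ Sig, ∀ σ' ∈ Sig, IsFaceOf (σ ∩ σ') σ ∧ IsFaceOf (σ ∩ σ') σ'

/-- A fan: a quasi-fan all of whose cones are strictly convex. -/
def IsFan {N : Type*} [AddCommGroup N] (Δ : Set (Set (NR N))) : Prop :=
  IsQuasiFan Δ ∧ ∀ σ ∈ Δ, σ ∩ (-σ) = ({0} : Set (NR N))

/-- A system of quasi-fans in the lattice `N`, indexed by `I`. -/
structure SysQFan (N : Type*) [AddCommGroup N] (I : Type*) where
  D : I → I → Set (Set (NR N))
  isQF : ∀ i j, IsQuasiFan (D i j)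
  symm : ∀ i j, D i j = D j i
  inter : ∀ i j k, D i j ∩ D j k ⊆ D i k

namespace SysQFan

variable {N : Type*} [AddCommGroup N] {I : Type*}

/-- A system of fans: a system of quasi-fans all of whose members are fans. -/
def IsFanSys (S : SysQFan N I) : Prop := ∀ i j, IsFan (S.D i j)

/-- An affine system: each `Σ_ii` consists of all the faces of a single cone. -/
def IsAffine (S : SysQFan N I) : Prop := ∀ i, ∃ σ, S.D i i = { τ | IsFaceOf τ σ }

/-- The set `𝔉(S)` of labelled cones of a system of quasi-fans. -/
def LCone (S : SysQFan N I) := { p : Set (NR N) × I // p.1 ∈ S.D p.2 p.2 }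

/-- The glueing relation `(σ,i) ∼ (τ,j) ↔ σ = τ ∧ σ ∈ Σ_ij` on labelled cones. -/
def glueSetoid (S : SysQFan N I) : Setoid (LCone S) where
  r p q := p.1.1 = q.1.1 ∧ p.1.1 ∈ S.D p.1.2 q.1.2
  iseqv := by
    refine ⟨fun p => ⟨rfl, p.2⟩, fun {p q} h => ⟨h.1.symm, ?_⟩,
      fun {p q r} h h' => ⟨h.1.trans h'.1, ?_⟩⟩
    · rw [S.symm, ← h.1]; exact h.2
    · exact S.inter _ _ _ ⟨h.2, by rw [h.1]; exact h'.2⟩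

/-- `Ω(S)`: the set of equivalence classes of labelled cones under the glueing relation. -/
def Omega (S : SysQFan N I) := Quotient (glueSetoid S)

/-- The class `[σ,i] ∈ Ω(S)` of a labelled cone `(σ,i)`. -/
def cls {S : SysQFan N I} (p : LCone S) : Omega S := Quotient.mk (glueSetoid S) p

/-- The partial order on `Ω(S)`:  `[τ,j] ≺ [σ,i]` iff `τ ≺ σ` and `[τ,i] = [τ,j]`. -/
def le (S : SysQFan N I) (a b : Omega S) : Prop :=
  ∃ p q : LCone S, cls p = a ∧ cls q = b ∧ IsFaceOf p.1.1 q.1.1 ∧ p.1.1 ∈ S.D p.1.2 q.1.2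

/-- A map of systems of quasi-fans: a lattice homomorphism `F` together with an order
preserving map `f : Ω(S) → Ω(S')` such that `f [σ,i] = [σ',i']` implies
`F_ℝ(σ°) ⊆ (σ')°`. -/
def IsSysMap {N' : Type*} [AddCommGroup N'] {I' : Type*} (S : SysQFan N I)
    (S' : SysQFan N' I') (F : N →ₗ[ℤ] N') (f : Omega S → Omega S') : Prop :=
  (∀ a b : Omega S, le S a b → le S' (f a) (f b)) ∧
    ∀ (p : LCone S) (q : LCone S'), f (cls p) = cls q →
      (LinearMap.baseChange ℝ F) '' coneRelint p.1.1 ⊆ coneRelint q.1.1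

/-- A single quasi-fan, regarded as a system of quasi-fans with one index. -/
def single {N' : Type*} [AddCommGroup N'] (Δ : Set (Set (NR N'))) (h : IsQuasiFan Δ) :
    SysQFan N' PUnit where
  D _ _ := Δ
  isQF _ _ := h
  symm _ _ := rfl
  inter _ _ _ := fun _ hσ => hσ.1

end SysQFan

/-- A lattice: a finitely generated free `ℤ`-module. -/
structure LatticeData where
  carrier : Type
  [grp : AddCommGroup carrier]
  [free : Module.Free ℤ carrier]
  [fin : Module.Finite ℤ carrier]

attribute [instance] LatticeData.grp LatticeData.free LatticeData.fin

/-- A rational polyhedral cone is a convex cone. -/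
theorem IsRatCone.isConeSet {N : Type*} [AddCommGroup N] {σ : Set (NR N)} (h : IsRatCone σ) :
    IsConeSet σ := by
  obtain ⟨m, v, rfl⟩ := h
  refine ⟨⟨0, fun _ => le_rfl, by simp⟩, ?_, ?_⟩
  · rintro _ ⟨c, hc, rfl⟩ _ ⟨d, hd, rfl⟩
    exact ⟨c + d, fun k => add_nonneg (hc k) (hd k), by
      simp [add_smul, Finset.sum_add_distrib]⟩
  · rintro r hr _ ⟨c, hc, rfl⟩
    exact ⟨fun k => r * c k, fun k => mul_nonneg hr (hc k), by
      simp [Finset.smul_sum, mul_smul]⟩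

/-- The image of a rational polyhedral cone under a lattice homomorphism is one. -/
theorem IsRatCone.image_baseChange {N N' : Type*} [AddCommGroup N] [AddCommGroup N']
    {σ : Set (NR N)} (h : IsRatCone σ) (F : N →ₗ[ℤ] N') :
    IsRatCone (LinearMap.baseChange ℝ F '' σ) := by
  obtain ⟨m, v, rfl⟩ := h
  have key (c : Fin m → ℝ) : LinearMap.baseChange ℝ F (∑ k, c k • toNR (v k)) =
      ∑ k, c k • toNR (F (v k)) := by
    simp only [map_sum, map_smul, toNR, LinearMap.baseChange_tmul]
  refine ⟨m, fun k => F (v k), Set.ext fun y => ⟨?_, ?_⟩⟩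
  · rintro ⟨_, ⟨c, hc, rfl⟩, rfl⟩
    exact ⟨c, hc, key c⟩
  · rintro ⟨c, hc, rfl⟩
    exact ⟨_, ⟨c, hc, rfl⟩, key c⟩

/-- The lineality space of a convex cone is closed under scaling by arbitrary reals. -/
theorem IsConeSet.smul_mem_lineality {V : Type*} [AddCommGroup V] [Module ℝ V] {σ : Set V}
    (h : IsConeSet σ) (r : ℝ) {x : V} (hx : x ∈ σ ∩ -σ) : r • x ∈ σ ∩ -σ := by
  obtain ⟨h1, h2⟩ := hx
  rw [Set.mem_neg] at h2
  rcases le_total 0 r with hr | hr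
  · exact ⟨h.2.2 r hr x h1, by simpa [Set.mem_neg] using h.2.2 r hr _ h2⟩
  · exact ⟨by simpa using h.2.2 (-r) (neg_nonneg.2 hr) _ h2,
      by simpa [Set.mem_neg] using h.2.2 (-r) (neg_nonneg.2 hr) _ h1⟩

/-- The lineality space of a convex cone is closed under addition. -/
theorem IsConeSet.add_mem_lineality {V : Type*} [AddCommGroup V] [Module ℝ V] {σ : Set V}
    (h : IsConeSet σ) {x y : V} (hx : x ∈ σ ∩ -σ) (hy : y ∈ σ ∩ -σ) : x + y ∈ σ ∩ -σ := by
  refine ⟨h.2.1 _ hx.1 _ hy.1, ?_⟩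
  rw [Set.mem_neg, neg_add]
  exact h.2.1 _ hx.2 _ hy.2

/-- The lineality space of a convex cone is a face of it. -/
theorem IsConeSet.mem_lineality_of_add_mem {V : Type*} [AddCommGroup V] [Module ℝ V]
    {σ : Set V} (h : IsConeSet σ) {x y : V} (hx : x ∈ σ) (hy : y ∈ σ)
    (hxy : x + y ∈ σ ∩ -σ) : x ∈ σ ∩ -σ := by
  refine ⟨hx, ?_⟩
  have := h.2.1 _ hxy.2 _ hy
  rw [Set.mem_neg]
  simpa [neg_add] using this

/-- The kernel of the real extension of the projection modulo the lattice points of the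
lineality space of a rational cone is that lineality space. -/
theorem IsRatCone.baseChange_mkQ_eq_zero_iff {N : Type*} [AddCommGroup N] {σ : Set (NR N)}
    (h : IsRatCone σ) {L : Submodule ℤ N} (hL : (L : Set N) = { n | toNR n ∈ σ ∩ -σ })
    (x : NR N) : LinearMap.baseChange ℝ L.mkQ x = 0 ↔ x ∈ σ ∩ -σ := by
  have hc := h.isConeSet
  have hmem (n : N) : n ∈ L ↔ toNR n ∈ σ ∩ -σ := by
    rw [← SetLike.mem_coe, hL, Set.mem_ofPred_eq]
  constructor
  · intro hx
    have hex := lTensor_exact ℝ (LinearMap.exact_subtype_mkQ L) L.mkQ_surjective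
    obtain ⟨t, rfl⟩ := (hex x).1 hx
    induction t using TensorProduct.induction_on with
    | zero => simpa using hc.1
    | tmul r l =>
      have h1 := hc.smul_mem_lineality r ((hmem l).1 l.2)
      simpa [toNR, TensorProduct.smul_tmul'] using h1
    | add a b ha hb =>
      rw [map_add]
      exact hc.add_mem_lineality (ha ((hex _).2 ⟨a, rfl⟩)) (hb ((hex _).2 ⟨b, rfl⟩))
  · intro hx
    obtain ⟨m, v, hv⟩ := h
    obtain ⟨c, hc0, rfl⟩ : ∃ c : Fin m → ℝ, (∀ k, 0 ≤ c k) ∧ x = ∑ k, c k • toNR (v k) := by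
      have := hx.1
      rwa [hv] at this
    have hsum (s : Finset (Fin m)) : ∑ k ∈ s, c k • toNR (v k) ∈ σ := by
      rw [hv]
      refine ⟨fun k => if k ∈ s then c k else 0, fun k => ?_, ?_⟩
      · dsimp only
        split_ifs
        exacts [hc0 k, le_rfl]
      · simp [ite_smul, Finset.sum_ite_mem]
    rw [map_sum]
    refine Finset.sum_eq_zero fun k _ => ?_
    rw [map_smul]
    rcases (hc0 k).eq_or_lt with h0 | h0
    · rw [← h0, zero_smul]
    have hk : c k • toNR (v k) ∈ σ ∩ -σ := by
      refine hc.mem_lineality_of_add_mem (y := ∑ j ∈ Finset.univ.erase k, c j • toNR (v j))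
        (by simpa using hsum {k}) (hsum _) ?_
      rwa [Finset.add_sum_erase _ (fun j => c j • toNR (v j)) (Finset.mem_univ k)]
    have hk' := hc.smul_mem_lineality (c k)⁻¹ hk
    rw [inv_smul_smul₀ h0.ne', ← hmem] at hk'
    rw [toNR, LinearMap.baseChange_tmul, Submodule.mkQ_apply,
      (Submodule.Quotient.mk_eq_zero L).2 hk', TensorProduct.tmul_zero, smul_zero]

/-- A linear map whose kernel lies in a convex cone detects membership in that cone. -/
theorem IsConeSet.map_mem_image_iff {V W : Type*} [AddCommGroup V] [Module ℝ V]
    [AddCommGroup W] [Module ℝ W] {σ : Set V} (h : IsConeSet σ) {f : V →ₗ[ℝ] W}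
    (hf : ∀ x, f x = 0 → x ∈ σ) {x : V} : f x ∈ f '' σ ↔ x ∈ σ := by
  refine ⟨?_, fun hx => ⟨x, hx, rfl⟩⟩
  rintro ⟨y, hy, hyx⟩
  have := h.2.1 _ hy _ (hf (x - y) (by rw [map_sub, hyx, sub_self]))
  rwa [add_sub_cancel] at this

/-- The image of a convex cone under a linear map is a convex cone. -/
theorem IsConeSet.image {V W : Type*} [AddCommGroup V] [Module ℝ V]
    [AddCommGroup W] [Module ℝ W] {σ : Set V} (h : IsConeSet σ) (f : V →ₗ[ℝ] W) :
    IsConeSet (f '' σ) := by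
  refine ⟨⟨0, h.1, map_zero f⟩, ?_, ?_⟩
  · rintro _ ⟨x, hx, rfl⟩ _ ⟨y, hy, rfl⟩
    exact ⟨x + y, h.2.1 x hx y hy, map_add f x y⟩
  · rintro r hr _ ⟨x, hx, rfl⟩
    exact ⟨r • x, h.2.2 r hr x hx, map_smul f r x⟩

/-- A linear map sends faces containing its kernel to faces. -/
theorem IsFaceOf.image {V W : Type*} [AddCommGroup V] [Module ℝ V]
    [AddCommGroup W] [Module ℝ W] {τ σ : Set V} (h : IsFaceOf τ σ) {f : V →ₗ[ℝ] W}
    (hf : ∀ x, f x = 0 → x ∈ τ) : IsFaceOf (f '' τ) (f '' σ) := by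
  refine ⟨h.1.image f, Set.image_mono h.2.1, ?_⟩
  rintro _ ⟨x, hx, rfl⟩ _ ⟨y, hy, rfl⟩ hxy
  rw [← map_add, h.1.map_mem_image_iff hf] at hxy
  obtain ⟨h1, h2⟩ := h.2.2 x hx y hy hxy
  exact ⟨⟨x, h1, rfl⟩, ⟨y, h2, rfl⟩⟩

/-- The preimage in a convex cone of a face of its image under a linear map is a face. -/
theorem IsFaceOf.inter_preimage {V W : Type*} [AddCommGroup V] [Module ℝ V]
    [AddCommGroup W] [Module ℝ W] {σ : Set V} {τ : Set W} {f : V →ₗ[ℝ] W}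
    (h : IsFaceOf τ (f '' σ)) (hσ : IsConeSet σ) : IsFaceOf (σ ∩ f ⁻¹' τ) σ := by
  obtain ⟨hc, -, hface⟩ := h
  refine ⟨⟨⟨hσ.1, by simpa using hc.1⟩, ?_, ?_⟩, Set.inter_subset_left, ?_⟩
  · rintro x ⟨hx, hx'⟩ y ⟨hy, hy'⟩
    exact ⟨hσ.2.1 x hx y hy, by simpa using hc.2.1 _ hx' _ hy'⟩
  · rintro r hr x ⟨hx, hx'⟩
    exact ⟨hσ.2.2 r hr x hx, by simpa using hc.2.2 r hr _ hx'⟩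
  · rintro x hx y hy ⟨-, hxy⟩
    rw [Set.mem_preimage, map_add] at hxy
    obtain ⟨h1, h2⟩ := hface _ ⟨x, hx, rfl⟩ _ ⟨y, hy, rfl⟩ hxy
    exact ⟨⟨hx, h1⟩, ⟨hy, h2⟩⟩

/-- **Remark 5.5.**  Let `Σ` be a quasi-fan in a lattice `N`, let `σ₀ = σ ∩ (−σ)` be the
common minimal face of all its cones, let `L := σ₀ ∩ N` and let `P : N → N/L` denote the
projection.  Then `Δ := {P_ℝ(σ) : σ ∈ Σ}` is a fan in `N/L`. -/
theorem quotient_of_quasifan_is_fan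
    {N : Type} [AddCommGroup N] [Module.Free ℤ N] [Module.Finite ℤ N]
    (Sig : Set (Set (NR N))) (hSig : IsQuasiFan Sig)
    (σ₀ : Set (NR N)) (h0 : ∀ σ ∈ Sig, σ ∩ (-σ) = σ₀)
    (L : Submodule ℤ N) (hL : (L : Set N) = { n | toNR n ∈ σ₀ }) :
    IsFan { ρ : Set (NR (N ⧸ L)) | ∃ σ ∈ Sig, ρ = LinearMap.baseChange ℝ L.mkQ '' σ } := by
  obtain ⟨hfin, hrat, hface, hinter⟩ := hSig
  have hker : ∀ σ ∈ Sig, ∀ x, LinearMap.baseChange ℝ L.mkQ x = 0 ↔ x ∈ σ ∩ -σ :=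
    fun σ hσ => (hrat σ hσ).baseChange_mkQ_eq_zero_iff (by rw [hL, h0 σ hσ])
  have hsub : ∀ σ ∈ Sig, ∀ x, LinearMap.baseChange ℝ L.mkQ x = 0 → x ∈ σ :=
    fun σ hσ x hx => ((hker σ hσ x).1 hx).1
  have hmem : ∀ σ ∈ Sig, ∀ x, LinearMap.baseChange ℝ L.mkQ x ∈
      LinearMap.baseChange ℝ L.mkQ '' σ ↔ x ∈ σ :=
    fun σ hσ x => (hrat σ hσ).isConeSet.map_mem_image_iff (hsub σ hσ)
  refine ⟨⟨?_, ?_, ?_, ?_⟩, ?_⟩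
  · refine (hfin.image fun σ => LinearMap.baseChange ℝ L.mkQ '' σ).subset ?_
    rintro _ ⟨σ, hσ, rfl⟩
    exact ⟨σ, hσ, rfl⟩
  · rintro _ ⟨σ, hσ, rfl⟩
    exact (hrat σ hσ).image_baseChange _
  · rintro _ ⟨σ, hσ, rfl⟩ τ hτ
    refine ⟨_, hface σ hσ _ (hτ.inter_preimage (hrat σ hσ).isConeSet), ?_⟩
    rw [Set.image_inter_preimage, Set.inter_eq_self_of_subset_right hτ.2.1]
  · rintro _ ⟨σ, hσ, rfl⟩ _ ⟨σ', hσ', rfl⟩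
    have himg : LinearMap.baseChange ℝ L.mkQ '' σ ∩ LinearMap.baseChange ℝ L.mkQ '' σ' =
        LinearMap.baseChange ℝ L.mkQ '' (σ ∩ σ') := by
      refine Set.Subset.antisymm ?_ (Set.image_inter_subset _ _ _)
      rintro _ ⟨⟨x, hx, rfl⟩, hx'⟩
      exact ⟨x, ⟨hx, (hmem σ' hσ' x).1 hx'⟩, rfl⟩
    have hk : ∀ x, LinearMap.baseChange ℝ L.mkQ x = 0 → x ∈ σ ∩ σ' :=
      fun x hx => ⟨hsub σ hσ x hx, hsub σ' hσ' x hx⟩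
    rw [himg]
    exact ⟨(hinter σ hσ σ' hσ').1.image hk, (hinter σ hσ σ' hσ').2.image hk⟩
  · rintro _ ⟨σ, hσ, rfl⟩
    refine Set.Subset.antisymm ?_ ?_
    · rintro _ ⟨⟨x, hx, rfl⟩, hx'⟩
      rw [Set.mem_neg, ← map_neg, hmem σ hσ] at hx'
      exact (hker σ hσ x).2 ⟨hx, hx'⟩
    · rintro _ rfl
      have h1 := (hrat σ hσ).isConeSet.1
      exact ⟨⟨0, h1, map_zero _⟩, ⟨0, h1, by simp⟩⟩
end
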